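/- arXiv:2504.02348 — 4 statements merged into one kernel-verified Lean document; each statement's English description precedes it below -/
import Mathlib

section
/- Let m ≥ 0 and n ≥ 1 be integers. Let Ω₁ and Ω₂ be open subsets of ℂⁿ, each containing (ℝ ∪ iℝ)ⁿ. Let f̃₁ : ℝᵐ × Ω₁ → ℂ and f̃₂ : ℝᵐ × Ω₂ → ℂ be functions such that for each fixed x ∈ ℝᵐ, the map z ↦ f̃₁(x,z) is holomorphic on Ω₁ and the map z ↦ f̃₂(x,z) is holomorphic on Ω₂. If f̃₁(x,y) = f̃₂(x,y) for all (x,y) ∈ ℝᵐ × ℝⁿ, then f̃₁(x,z) = f̃₂(x,z) for all x ∈ ℝᵐ and all z ∈ (ℝ ∪ iℝ)ⁿ. -/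
open MeasureTheory Filter

/-- The set of points of `ℂⁿ` all of whose coordinates are either real or purely
imaginary, i.e. `(ℝ ∪ iℝ)ⁿ`. -/
def realOrImag (n : ℕ) : Set (Fin n → ℂ) :=
  {z | ∀ j, (z j).im = 0 ∨ (z j).re = 0}

/-- The union of the coordinate axes of `ℂ` is preconnected. -/
lemma isPreconnected_re_or_im_eq_zero :
    IsPreconnected {t : ℂ | t.im = 0 ∨ t.re = 0} := by
  have hstar : StarConvex ℝ (0 : ℂ) {t : ℂ | t.im = 0 ∨ t.re = 0} := by
    rw [starConvex_zero_iff]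
    rintro t (ht | ht) a - -
    · left; simp [ht]
    · right; simp [ht]
  exact (hstar.isPathConnected (by simp)).isConnected.isPreconnected

/-- Two functions of one complex variable which are holomorphic near the coordinate axes and
agree on the real axis also agree on the imaginary axis. -/
lemma eqOn_axes_of_eqOn_real {U : Set ℂ} (hU : IsOpen U)
    (hsub : {t : ℂ | t.im = 0 ∨ t.re = 0} ⊆ U) {f g : ℂ → ℂ}
    (hf : DifferentiableOn ℂ f U) (hg : DifferentiableOn ℂ g U)
    (h : ∀ r : ℝ, f r = g r) :
    Set.EqOn f g {t : ℂ | t.im = 0 ∨ t.re = 0} := by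
  refine AnalyticOnNhd.eqOn_of_preconnected_of_frequently_eq
    ((hf.analyticOnNhd hU).mono hsub) ((hg.analyticOnNhd hU).mono hsub)
    isPreconnected_re_or_im_eq_zero (z₀ := 0) (by simp) ?_
  have htend : Tendsto (fun r : ℝ => (r : ℂ)) (nhdsWithin 0 {0}ᶜ) (nhdsWithin 0 {0}ᶜ) := by
    refine tendsto_nhdsWithin_of_tendsto_nhds_of_eventually_within _ ?_ ?_
    · exact (Complex.continuous_ofReal.tendsto' 0 0 (by simp)).mono_left nhdsWithin_le_nhds
    · filter_upwards [self_mem_nhdsWithin] with r hr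
      simpa using hr
  exact htend.frequently (Eventually.frequently (Eventually.of_forall h))

/-- Two functions which are holomorphic near `(ℝ ∪ iℝ)ⁿ` and agree on `ℝⁿ` agree at every point
of `(ℝ ∪ iℝ)ⁿ`. -/
lemma eqOn_realOrImag_of_eqOn_real {n : ℕ} {Ω : Set (Fin n → ℂ)} (hΩ : IsOpen Ω)
    (hsub : realOrImag n ⊆ Ω) {f g : (Fin n → ℂ) → ℂ}
    (hf : DifferentiableOn ℂ f Ω) (hg : DifferentiableOn ℂ g Ω)
    (h : ∀ y : Fin n → ℝ, f (fun j => (y j : ℂ)) = g (fun j => (y j : ℂ))) :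
    Set.EqOn f g (realOrImag n) := by
  have key : ∀ (S : Finset (Fin n)) (z : Fin n → ℂ), z ∈ realOrImag n →
      (∀ j ∉ S, (z j).im = 0) → f z = g z := by
    intro S
    induction S using Finset.induction_on with
    | empty =>
      intro z _ hz
      have hre : z = fun j => (((z j).re : ℝ) : ℂ) := by
        funext j
        exact Complex.ext (by simp) (by simpa using hz j (by simp))
      rw [hre]
      exact h _
    | insert k S _ ih =>
      intro z hz hreal
      have hupd : ∀ t : ℂ, t.im = 0 ∨ t.re = 0 → Function.update z k t ∈ realOrImag n := by
        intro t ht j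
        rcases eq_or_ne j k with rfl | hj
        · simpa using ht
        · simpa [hj] using hz j
      have hdiff : Differentiable ℂ (fun t : ℂ => Function.update z k t) := fun t =>
        (hasFDerivAt_update z t).differentiableAt
      have hEq := eqOn_axes_of_eqOn_real (hΩ.preimage hdiff.continuous)
        (fun t ht => hsub (hupd t ht))
        (hf.comp hdiff.differentiableOn (Set.mapsTo_preimage _ _))
        (hg.comp hdiff.differentiableOn (Set.mapsTo_preimage _ _))
        (fun r => ih _ (hupd r (by simp)) fun j hj => by
          rcases eq_or_ne j k with rfl | hjk
          · simp
          · simpa [hjk] using hreal j (by simp [hjk, hj]))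
      simpa using hEq (hz k)
  exact fun z hz => key Finset.univ z hz (by simp)

/-- if two functions `f̃₁ : ℝᵐ × Ω₁ → ℂ`, `f̃₂ : ℝᵐ × Ω₂ → ℂ`, holomorphic in the
last `n` variables on open sets `Ω₁, Ω₂ ⊇ (ℝ ∪ iℝ)ⁿ`, agree on `ℝᵐ × ℝⁿ`, then they agree on
`ℝᵐ × (ℝ ∪ iℝ)ⁿ`. -/
theorem uniqueness_of_analytic_continuation
    (m n : ℕ) (hn : 1 ≤ n)
    (Ω₁ Ω₂ : Set (Fin n → ℂ)) (hΩ₁ : IsOpen Ω₁) (hΩ₂ : IsOpen Ω₂)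
    (hΩ₁R : realOrImag n ⊆ Ω₁) (hΩ₂R : realOrImag n ⊆ Ω₂)
    (f₁ f₂ : (Fin m → ℝ) → (Fin n → ℂ) → ℂ)
    (hf₁ : ∀ x : Fin m → ℝ, DifferentiableOn ℂ (f₁ x) Ω₁)
    (hf₂ : ∀ x : Fin m → ℝ, DifferentiableOn ℂ (f₂ x) Ω₂)
    (heq : ∀ (x : Fin m → ℝ) (y : Fin n → ℝ),
      f₁ x (fun j => (y j : ℂ)) = f₂ x (fun j => (y j : ℂ))) :
    ∀ (x : Fin m → ℝ) (z : Fin n → ℂ), z ∈ realOrImag n → f₁ x z = f₂ x z := by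
  intro x
  exact eqOn_realOrImag_of_eqOn_real (hΩ₁.inter hΩ₂) (Set.subset_inter hΩ₁R hΩ₂R)
    ((hf₁ x).mono Set.inter_subset_left) ((hf₂ x).mono Set.inter_subset_right) (heq x)
end

section
/- Let n ≥ 1, let h : ℂⁿ → ℂ be holomorphic (entire), and let T > 0 and C > 0 be such that |h(z)| ≤ C·exp(‖z‖²/(4T)) for all z ∈ ℂⁿ. For t ∈ [0,T) and x ∈ ℝⁿ define f(t,x) := ∫_{ℝⁿ} h(x + i√(2t)·y) dγₙ(y). Then: (1) for every t ∈ [0,T) and x ∈ ℝⁿ the map y ↦ h(x + i√(2t)·y) is γₙ-integrable, so f is well-defined; (2) f is continuous on [0,T) × ℝⁿ and f(0,x) = h(x) for all x ∈ ℝⁿ; (3) for every (t,x) ∈ (0,T) × ℝⁿ, the partial derivative ∂f/∂t(t,x) and the second partial derivatives ∂²f/∂xⱼ²(t,x) (1 ≤ j ≤ n) exist and satisfy ∂f/∂t(t,x) = -∑_{j=1}^{n} ∂²f/∂xⱼ²(t,x); that is, f solves the backward heat equation on (0,T) × ℝⁿ with initial condition h restricted to ℝⁿ. -/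
open MeasureTheory ProbabilityTheory Filter

/-- The standard Gaussian probability measure on `ℝⁿ` (product of standard Gaussians). -/
noncomputable def stdGaussianPi (n : ℕ) : Measure (Fin n → ℝ) :=
  Measure.pi fun _ => gaussianReal 0 1

/-- The point `x + i√(2t)·y` of `ℂⁿ`, for `x, y ∈ ℝⁿ` and `t ∈ ℝ`. -/
noncomputable def heatPoint (n : ℕ) (t : ℝ) (x y : Fin n → ℝ) : EuclideanSpace ℂ (Fin n) :=
  (EuclideanSpace.equiv (Fin n) ℂ).symm
    (fun j => (x j : ℂ) + Complex.I * (Real.sqrt (2 * t) : ℂ) * (y j : ℂ))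

/-- `f(t,x) := ∫_{ℝⁿ} h(x + i√(2t)·y) dγₙ(y)`. -/
noncomputable def heatSol (n : ℕ) (h : EuclideanSpace ℂ (Fin n) → ℂ)
    (t : ℝ) (x : Fin n → ℝ) : ℂ :=
  ∫ y : Fin n → ℝ, h (heatPoint n t x y) ∂ stdGaussianPi n

open scoped Topology

/-- `g` is measurable and its restrictions to complex lines in the direction `v` are entire. -/
structure EntireAlong {E : Type*} [NormedAddCommGroup E] [NormedSpace ℂ E] [MeasurableSpace E]
    (v : E) (g : E → ℂ) : Prop where
  measurable : Measurable g
  differentiable (z : E) : Differentiable ℂ fun ζ : ℂ => g (z + ζ • v)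

/-- `g` grows at most like a multiple of `exp (‖z‖² / (4T))`. -/
def HasGaussianGrowth {E : Type*} [NormedAddCommGroup E] (T : ℝ) (g : E → ℂ) : Prop :=
  ∃ C : ℝ, 0 ≤ C ∧ ∀ z, ‖g z‖ ≤ C * Real.exp (‖z‖ ^ 2 / (4 * T))

lemma lineDeriv_add_smul {E : Type*} [NormedAddCommGroup E] [NormedSpace ℂ E]
    (g : E → ℂ) (v z : E) (ζ : ℂ) :
    lineDeriv ℂ g (z + ζ • v) v = deriv (fun ξ : ℂ => g (z + ξ • v)) ζ := by
  have := deriv_comp_const_add (f := fun ξ : ℂ => g (z + ξ • v)) ζ 0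
  simpa [lineDeriv, add_smul, add_assoc] using this

section EntireAlong

variable {E : Type*} [NormedAddCommGroup E] [NormedSpace ℂ E] [MeasurableSpace E]
  {v : E} {g : E → ℂ}

lemma EntireAlong.hasDerivAt (hg : EntireAlong v g) (z : E) (ζ : ℂ) :
    HasDerivAt (fun ξ : ℂ => g (z + ξ • v)) (lineDeriv ℂ g (z + ζ • v) v) ζ := by
  rw [lineDeriv_add_smul]
  exact (hg.differentiable z ζ).hasDerivAt

lemma EntireAlong.lineDeriv [BorelSpace E] (hg : EntireAlong v g) :
    EntireAlong v fun z => lineDeriv ℂ g z v where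
  measurable := by
    refine measurable_of_tendsto_metrizable (f := fun (k : ℕ) z =>
      ((1 / ((k : ℝ) + 1) : ℝ) : ℂ)⁻¹ • (g (z + ((1 / ((k : ℝ) + 1) : ℝ) : ℂ) • v) - g z)) ?_ ?_
    · intro k
      exact Measurable.const_smul ((hg.measurable.comp (continuous_add_const _).measurable).sub
        hg.measurable) (_ : ℂ)
    · rw [tendsto_pi_nhds]
      intro z
      have h1 := hg.hasDerivAt z 0
      have h2 := h1.tendsto_slope_zero
      simp only [zero_smul, add_zero, zero_add] at h2
      refine h2.comp ?_
      rw [tendsto_nhdsWithin_iff]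
      constructor
      · have := (Complex.continuous_ofReal.tendsto 0).comp
          (tendsto_one_div_add_atTop_nhds_zero_nat (𝕜 := ℝ))
        simpa [Function.comp_def] using this
      · refine Eventually.of_forall fun k => ?_
        simp only [Set.mem_compl_iff, Set.mem_singleton_iff, Complex.ofReal_eq_zero]
        positivity
  differentiable z := by
    simp_rw [lineDeriv_add_smul]
    exact (hg.differentiable z).deriv

lemma HasGaussianGrowth.lineDeriv (hg : EntireAlong v g) (hv : ‖v‖ ≤ 1) {T T' : ℝ}
    (hT' : 0 < T') (hTT' : T' < T) (h : HasGaussianGrowth T g) :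
    HasGaussianGrowth T' fun z => lineDeriv ℂ g z v := by
  obtain ⟨C, hC, hb⟩ := h
  have hT : 0 < T := hT'.trans hTT'
  have hd : 0 < T - T' := sub_pos.2 hTT'
  refine ⟨C * Real.exp (1 / (4 * (T - T'))), by positivity, fun z => ?_⟩
  rw [mul_assoc, ← Real.exp_add]
  beta_reduce
  rw [_root_.lineDeriv]
  refine (Complex.norm_deriv_le_of_forall_mem_sphere_norm_le one_pos
    (hg.differentiable z).diffContOnCl fun ζ hζ => (hb _).trans ?_).trans_eq (div_one _)
  gcongr
  have hζ' : ‖ζ‖ = 1 := by simpa using hζ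
  have hn : ‖z + ζ • v‖ ≤ ‖z‖ + 1 := by
    refine (norm_add_le _ _).trans ?_
    rw [norm_smul, hζ', one_mul]
    gcongr
  have h1 : ‖z + ζ • v‖ ^ 2 / (4 * T) ≤ (‖z‖ + 1) ^ 2 / (4 * T) := by gcongr
  refine h1.trans ?_
  have key : 1 / (4 * (T - T')) + ‖z‖ ^ 2 / (4 * T') - (‖z‖ + 1) ^ 2 / (4 * T)
      = (‖z‖ * (T - T') - T') ^ 2 / (4 * T * T' * (T - T')) := by
    field_simp
    ring
  have : 0 ≤ (‖z‖ * (T - T') - T') ^ 2 / (4 * T * T' * (T - T')) := by positivity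
  linarith

end EntireAlong

section StdGaussianPi

instance (n : ℕ) : IsProbabilityMeasure (stdGaussianPi n) := by
  unfold stdGaussianPi
  infer_instance

lemma stdGaussianPi_eq_withDensity (n : ℕ) :
    stdGaussianPi n = volume.withDensity fun y : Fin n → ℝ =>
      ENNReal.ofReal (∏ j, gaussianPDFReal 0 1 (y j)) := by
  refine Measure.pi_eq fun s hs => ?_
  rw [withDensity_apply _ (MeasurableSet.univ_pi hs), volume_pi, Measure.restrict_pi_pi]
  simp_rw [gaussianReal_apply_eq_integral 0 one_ne_zero]
  rw [← ENNReal.ofReal_prod_of_nonneg fun i _ => integral_nonneg (gaussianPDFReal_nonneg _ _),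
    ← integral_fintype_prod_eq_prod (fun _ => gaussianPDFReal 0 1),
    ofReal_integral_eq_lintegral_ofReal]
  · exact Integrable.fintype_prod fun i => (integrable_gaussianPDFReal 0 1).restrict
  · exact ae_of_all _ fun y => Finset.prod_nonneg fun i _ => gaussianPDFReal_nonneg _ _ _

lemma measurable_prod_gaussianPDFReal (n : ℕ) :
    Measurable fun y : Fin n → ℝ => ∏ j, gaussianPDFReal 0 1 (y j) := by
  fun_prop

lemma integrable_stdGaussianPi_iff {n : ℕ} {g : (Fin n → ℝ) → ℂ} :
    Integrable g (stdGaussianPi n) ↔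
      Integrable fun y => (∏ j, gaussianPDFReal 0 1 (y j)) • g y := by
  rw [stdGaussianPi_eq_withDensity, integrable_withDensity_iff_integrable_smul'
    (measurable_prod_gaussianPDFReal n).ennreal_ofReal (ae_of_all _ fun _ => ENNReal.ofReal_lt_top)]
  simp_rw [ENNReal.toReal_ofReal (Finset.prod_nonneg fun i _ => gaussianPDFReal_nonneg _ _ _)]

lemma integral_stdGaussianPi {n : ℕ} (g : (Fin n → ℝ) → ℂ) :
    ∫ y, g y ∂stdGaussianPi n = ∫ y, (∏ j, gaussianPDFReal 0 1 (y j)) • g y := by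
  rw [stdGaussianPi_eq_withDensity, integral_withDensity_eq_integral_toReal_smul
    (measurable_prod_gaussianPDFReal n).ennreal_ofReal (ae_of_all _ fun _ => ENNReal.ofReal_lt_top)]
  simp_rw [ENNReal.toReal_ofReal (Finset.prod_nonneg fun i _ => gaussianPDFReal_nonneg _ _ _)]

lemma hasDerivAt_gaussianPDFReal (a : ℝ) :
    HasDerivAt (gaussianPDFReal 0 1) (-a * gaussianPDFReal 0 1 a) a := by
  have h : HasDerivAt (fun x : ℝ => -(x - 0) ^ 2 / (2 * ((1 : NNReal) : ℝ))) (-a) a := by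
    have := (((hasDerivAt_id a).sub_const 0).pow 2).neg.div_const (2 * ((1 : NNReal) : ℝ))
    refine this.congr_deriv ?_
    simp
    ring
  have := h.exp.const_mul (√(2 * Real.pi * ((1 : NNReal) : ℝ)))⁻¹
  rw [gaussianPDFReal_def]
  refine this.congr_deriv ?_
  ring

lemma hasLineDerivAt_prod_gaussianPDFReal {n : ℕ} (y : Fin n → ℝ) (j : Fin n) :
    HasLineDerivAt ℝ (fun y : Fin n → ℝ => ∏ i, gaussianPDFReal 0 1 (y i))
      (-y j * ∏ i, gaussianPDFReal 0 1 (y i)) y (Pi.single j 1) := by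
  have h : (fun t : ℝ => ∏ i, gaussianPDFReal 0 1 ((y + t • (Pi.single j 1 : Fin n → ℝ)) i)) =
      fun t => gaussianPDFReal 0 1 (y j + t) *
        ∏ i ∈ Finset.univ.erase j, gaussianPDFReal 0 1 (y i) := by
    funext t
    rw [← Finset.mul_prod_erase _ _ (Finset.mem_univ j)]
    congr 1
    · simp
    · refine Finset.prod_congr rfl fun i hi => ?_
      simp [Finset.ne_of_mem_erase hi]
  rw [HasLineDerivAt, h, ← Finset.mul_prod_erase _ _ (Finset.mem_univ j), ← mul_assoc]
  refine HasDerivAt.mul_const ?_ _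
  have := hasDerivAt_gaussianPDFReal (y j + 0)
  simpa using this.comp_const_add (y j) 0

/-- Gaussian integration by parts (Stein's identity) in the direction of a coordinate axis. -/
lemma integral_mul_stdGaussianPi {n : ℕ} (j : Fin n) {g g' : (Fin n → ℝ) → ℂ}
    (hg : Integrable g (stdGaussianPi n)) (hg' : Integrable g' (stdGaussianPi n))
    (hyg : Integrable (fun y => (y j : ℂ) * g y) (stdGaussianPi n))
    (hd : ∀ y, HasLineDerivAt ℝ g (g' y) y (Pi.single j 1)) :
    ∫ y, (y j : ℂ) * g y ∂stdGaussianPi n = ∫ y, g' y ∂stdGaussianPi n := by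
  rw [integrable_stdGaussianPi_iff] at hg hg' hyg
  have e (y : Fin n → ℝ) : (-y j * ∏ i, gaussianPDFReal 0 1 (y i)) • g y =
      -((∏ i, gaussianPDFReal 0 1 (y i)) • ((y j : ℂ) * g y)) := by
    simp only [Complex.real_smul]
    push_cast
    ring
  have := integral_bilinear_hasLineDerivAt_right_eq_neg_left_of_integrable (μ := volume)
    (f := fun y : Fin n → ℝ => ∏ i, gaussianPDFReal 0 1 (y i)) (g := g)
    (f' := fun y => -y j * ∏ i, gaussianPDFReal 0 1 (y i)) (g' := g') (v := Pi.single j 1)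
    (B := ContinuousLinearMap.lsmul ℝ ℝ)
    (by simpa only [ContinuousLinearMap.lsmul_apply, e] using hyg.fun_neg)
    (by simpa only [ContinuousLinearMap.lsmul_apply] using hg')
    (by simpa only [ContinuousLinearMap.lsmul_apply] using hg)
    (fun y _ => hasLineDerivAt_prod_gaussianPDFReal y j) (fun y _ => hd y)
  simp only [ContinuousLinearMap.lsmul_apply, e, integral_neg, neg_neg] at this
  rw [integral_stdGaussianPi, integral_stdGaussianPi, this]

lemma integrable_exp_mul_sum_sq {n : ℕ} {a : ℝ} (ha : a < 1 / 2) :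
    Integrable (fun y : Fin n → ℝ => Real.exp (a * ∑ j, y j ^ 2)) (stdGaussianPi n) := by
  simp_rw [Finset.mul_sum, Real.exp_sum]
  refine Integrable.fintype_prod (f := fun _ x => Real.exp (a * x ^ 2)) fun j => ?_
  rw [gaussianReal_of_var_ne_zero _ one_ne_zero, integrable_withDensity_iff_integrable_smul'
    (measurable_gaussianPDF 0 1) (ae_of_all _ fun _ => gaussianPDF_lt_top)]
  refine ((integrable_exp_neg_mul_sq (sub_pos.2 ha)).const_mul
    (√(2 * Real.pi * ((1 : NNReal) : ℝ)))⁻¹).congr (ae_of_all _ fun x => ?_)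
  simp only [toReal_gaussianPDF, gaussianPDFReal, smul_eq_mul, mul_assoc, ← Real.exp_add]
  congr 2
  push_cast
  ring

end StdGaussianPi

section HeatPoint

variable {n : ℕ}

lemma heatPoint_apply (t : ℝ) (x y : Fin n → ℝ) (j : Fin n) :
    heatPoint n t x y j = (x j : ℂ) + Complex.I * (√(2 * t) : ℂ) * (y j : ℂ) := rfl

lemma continuous_heatPoint :
    Continuous fun p : (ℝ × (Fin n → ℝ)) × (Fin n → ℝ) => heatPoint n p.1.1 p.1.2 p.2 := by
  unfold heatPoint
  fun_prop

lemma continuous_heatPoint_right (t : ℝ) (x : Fin n → ℝ) : Continuous (heatPoint n t x) :=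
  continuous_heatPoint.comp (Continuous.prodMk_right (t, x))

lemma norm_heatPoint_sq {t : ℝ} (ht : 0 ≤ t) (x y : Fin n → ℝ) :
    ‖heatPoint n t x y‖ ^ 2 = ∑ j, x j ^ 2 + 2 * t * ∑ j, y j ^ 2 := by
  rw [EuclideanSpace.norm_sq_eq, Finset.mul_sum, ← Finset.sum_add_distrib]
  refine Finset.sum_congr rfl fun j _ => ?_
  have : heatPoint n t x y j = (x j : ℂ) + ((√(2 * t) * y j : ℝ) : ℂ) * Complex.I := by
    rw [heatPoint_apply]
    push_cast
    ring
  rw [this, Complex.sq_norm, Complex.normSq_add_mul_I, mul_pow, Real.sq_sqrt (by positivity)]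

lemma heatPoint_update (t : ℝ) (x y : Fin n → ℝ) (j : Fin n) (u : ℝ) :
    heatPoint n t (Function.update x j u) y =
      heatPoint n t (Function.update x j 0) y + (u : ℂ) • EuclideanSpace.single j (1 : ℂ) := by
  ext i
  rcases eq_or_ne i j with rfl | hij
  · simp [heatPoint_apply, add_comm]
  · simp [heatPoint_apply, hij]

lemma heatPoint_add_smul_single (t : ℝ) (x y : Fin n → ℝ) (j : Fin n) (s : ℝ) :
    heatPoint n t x (y + s • Pi.single j 1) = heatPoint n t x y +
      (Complex.I * (√(2 * t) : ℂ) * (s : ℂ)) • EuclideanSpace.single j (1 : ℂ) := by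
  ext i
  rcases eq_or_ne i j with rfl | hij
  · simp [heatPoint_apply]
    ring
  · simp [heatPoint_apply, hij]

lemma hasDerivAt_heatPoint {t : ℝ} (ht : 0 < t) (x y : Fin n → ℝ) :
    HasDerivAt (fun s => heatPoint n s x y)
      (∑ j, (Complex.I / (√(2 * t) : ℂ) * (y j : ℂ)) • EuclideanSpace.single j (1 : ℂ)) t := by
  have hs : HasDerivAt (fun s : ℝ => √(2 * s)) (1 / √(2 * t)) t := by
    have := ((hasDerivAt_id t).const_mul 2).sqrt (by simpa using ht.ne')
    refine this.congr_deriv ?_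
    simp only [id]
    field_simp
  unfold heatPoint
  have hpi : HasDerivAt
      (fun s (j : Fin n) => (x j : ℂ) + Complex.I * (√(2 * s) : ℂ) * (y j : ℂ))
      (fun j => Complex.I / (√(2 * t) : ℂ) * (y j : ℂ)) t := by
    rw [hasDerivAt_pi]
    intro j
    have := ((hs.ofReal_comp.const_mul Complex.I).mul_const (y j : ℂ)).const_add (x j : ℂ)
    refine this.congr_deriv ?_
    push_cast
    ring
  have := ((EuclideanSpace.equiv (Fin n) ℂ).symm.toContinuousLinearMap.restrictScalars
    ℝ).hasFDerivAt.comp_hasDerivAt t hpi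
  refine this.congr_deriv ?_
  ext i
  simp [Pi.single_apply]

lemma norm_comp_heatPoint_le {g : EuclideanSpace ℂ (Fin n) → ℂ} {C T t a R : ℝ} (hT : 0 < T)
    (hC : 0 ≤ C) (hg : ∀ z, ‖g z‖ ≤ C * Real.exp (‖z‖ ^ 2 / (4 * T))) (ht : 0 ≤ t) (hta : t ≤ a)
    {x : Fin n → ℝ} (hx : ∑ j, x j ^ 2 ≤ R) (y : Fin n → ℝ) :
    ‖g (heatPoint n t x y)‖ ≤
      C * Real.exp (R / (4 * T)) * Real.exp (a / (2 * T) * ∑ j, y j ^ 2) := by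
  refine (hg _).trans ?_
  rw [mul_assoc, ← Real.exp_add]
  gcongr
  rw [norm_heatPoint_sq ht]
  have hq : 0 ≤ ∑ j, y j ^ 2 := Finset.sum_nonneg fun j _ => sq_nonneg _
  have : R / (4 * T) + a / (2 * T) * ∑ j, y j ^ 2 = (R + 2 * a * ∑ j, y j ^ 2) / (4 * T) := by
    field_simp
    ring
  rw [this]
  gcongr

lemma abs_mul_exp_le {a b : ℝ} (hab : a < b) (y : Fin n → ℝ) (j : Fin n) :
    |y j| * Real.exp (a * ∑ i, y i ^ 2) ≤
      (1 / (b - a) + 1) * Real.exp (b * ∑ i, y i ^ 2) := by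
  have hd : 0 < b - a := sub_pos.2 hab
  have hq : y j ^ 2 ≤ ∑ i, y i ^ 2 :=
    Finset.single_le_sum (f := fun i => y i ^ 2) (fun i _ => sq_nonneg _) (Finset.mem_univ j)
  have h1 : |y j| ≤ (1 / (b - a) + 1) * Real.exp ((b - a) * ∑ i, y i ^ 2) := by
    have h2 := Real.add_one_le_exp ((b - a) * ∑ i, y i ^ 2)
    have h3 : (b - a) * y j ^ 2 ≤ (b - a) * ∑ i, y i ^ 2 := by gcongr
    have h4 : (1 / (b - a) + 1) * ((b - a) * y j ^ 2 + 1) ≤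
        (1 / (b - a) + 1) * Real.exp ((b - a) * ∑ i, y i ^ 2) := by
      gcongr
      linarith
    refine le_trans ?_ h4
    have h5 : (1 / (b - a) + 1) * ((b - a) * y j ^ 2 + 1) =
        y j ^ 2 + 1 / (b - a) + (b - a) * y j ^ 2 + 1 := by
      field_simp
      ring
    rw [h5, ← sq_abs]
    have : 0 < 1 / (b - a) := by positivity
    nlinarith [sq_nonneg (|y j| - 1), sq_nonneg |y j|, abs_nonneg (y j),
      mul_nonneg hd.le (sq_nonneg |y j|)]
  calc _ ≤ (1 / (b - a) + 1) * Real.exp ((b - a) * ∑ i, y i ^ 2) *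
        Real.exp (a * ∑ i, y i ^ 2) := by gcongr
    _ = _ := by
      rw [mul_assoc, ← Real.exp_add]
      ring_nf

lemma integrable_abs_mul_exp_mul_sum_sq {a : ℝ} (ha : a < 1 / 2) (j : Fin n) :
    Integrable (fun y : Fin n → ℝ => |y j| * Real.exp (a * ∑ i, y i ^ 2)) (stdGaussianPi n) := by
  obtain ⟨b, hab, hb⟩ := exists_between ha
  refine ((integrable_exp_mul_sum_sq hb).const_mul (1 / (b - a) + 1)).mono'
    (by fun_prop) (ae_of_all _ fun y => ?_)
  rw [Real.norm_of_nonneg (by positivity)]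
  exact abs_mul_exp_le hab y j

lemma HasGaussianGrowth.integrable_comp_heatPoint {g : EuclideanSpace ℂ (Fin n) → ℂ} {T t : ℝ}
    (hg : Measurable g) (h : HasGaussianGrowth T g) (ht : 0 ≤ t) (htT : t < T) (x : Fin n → ℝ) :
    Integrable (fun y => g (heatPoint n t x y)) (stdGaussianPi n) := by
  obtain ⟨C, hC, hb⟩ := h
  have hT : 0 < T := ht.trans_lt htT
  have ha : t / (2 * T) < 1 / 2 := by
    rw [div_lt_div_iff₀ (by positivity) two_pos]
    linarith
  exact ((integrable_exp_mul_sum_sq ha).const_mul _).mono'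
    (hg.comp (continuous_heatPoint_right t x).measurable).aestronglyMeasurable
    (ae_of_all _ fun y => norm_comp_heatPoint_le hT hC hb ht le_rfl le_rfl y)

lemma HasGaussianGrowth.integrable_mul_comp_heatPoint {g : EuclideanSpace ℂ (Fin n) → ℂ} {T t : ℝ}
    (hg : Measurable g) (h : HasGaussianGrowth T g) (ht : 0 ≤ t) (htT : t < T) (x : Fin n → ℝ)
    (j : Fin n) :
    Integrable (fun y => (y j : ℂ) * g (heatPoint n t x y)) (stdGaussianPi n) := by
  obtain ⟨C, hC, hb⟩ := h
  have hT : 0 < T := ht.trans_lt htT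
  have ha : t / (2 * T) < 1 / 2 := by
    rw [div_lt_div_iff₀ (by positivity) two_pos]
    linarith
  refine ((integrable_abs_mul_exp_mul_sum_sq ha j).const_mul
    (C * Real.exp ((∑ j, x j ^ 2) / (4 * T)))).mono' ?_ (ae_of_all _ fun y => ?_)
  · have := hg.comp (continuous_heatPoint_right t x).measurable
    exact (Measurable.mul (by fun_prop) this).aestronglyMeasurable
  · rw [norm_mul, Complex.norm_real, Real.norm_eq_abs, mul_left_comm]
    gcongr
    exact norm_comp_heatPoint_le hT hC hb ht le_rfl le_rfl y

lemma continuousOn_heatSol {h : EuclideanSpace ℂ (Fin n) → ℂ} {T : ℝ} (hc : Continuous h)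
    (hT : 0 < T) (hg : HasGaussianGrowth T h) :
    ContinuousOn (fun p : ℝ × (Fin n → ℝ) => heatSol n h p.1 p.2) (Set.Ico 0 T ×ˢ Set.univ) := by
  obtain ⟨C, hC, hb⟩ := hg
  rintro ⟨t, x⟩ ⟨⟨ht, htT⟩, -⟩
  obtain ⟨a, hta, haT⟩ := exists_between htT
  have ha : a / (2 * T) < 1 / 2 := by
    rw [div_lt_div_iff₀ (by positivity) two_pos]
    linarith
  have hx : ∀ᶠ p : ℝ × (Fin n → ℝ) in 𝓝 (t, x), ∑ j, p.2 j ^ 2 < ∑ j, x j ^ 2 + 1 :=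
    ContinuousAt.eventually_lt (by fun_prop) continuousAt_const (by simp)
  have hta' : ∀ᶠ p : ℝ × (Fin n → ℝ) in 𝓝 (t, x), p.1 < a :=
    ContinuousAt.eventually_lt (by fun_prop) continuousAt_const hta
  refine continuousWithinAt_of_dominated
    (F := fun (p : ℝ × (Fin n → ℝ)) y => h (heatPoint n p.1 p.2 y))
    (Eventually.of_forall fun p =>
      (hc.comp (continuous_heatPoint_right p.1 p.2)).aestronglyMeasurable) ?_
    ((integrable_exp_mul_sum_sq ha).const_mul
      (C * Real.exp ((∑ j, x j ^ 2 + 1) / (4 * T))))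
    (ae_of_all _ fun y => Continuous.continuousWithinAt
      (hc.comp (continuous_heatPoint.comp (Continuous.prodMk_left y))))
  filter_upwards [nhdsWithin_le_nhds hx, nhdsWithin_le_nhds hta', self_mem_nhdsWithin]
    with p hp1 hp2 hp3
  exact ae_of_all _ fun y => norm_comp_heatPoint_le hT hC hb hp3.1.1 hp2.le hp1.le y

lemma hasDerivAt_heatSol_update {g : EuclideanSpace ℂ (Fin n) → ℂ} {T t : ℝ} (j : Fin n)
    (hg : EntireAlong (EuclideanSpace.single j (1 : ℂ)) g) (h : HasGaussianGrowth T g)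
    (ht : 0 ≤ t) (htT : t < T) (x : Fin n → ℝ) (u : ℝ) :
    HasDerivAt (fun u : ℝ => heatSol n g t (Function.update x j u))
      (heatSol n (fun z => lineDeriv ℂ g z (EuclideanSpace.single j 1)) t
        (Function.update x j u)) u := by
  obtain ⟨T', htT', hT'T⟩ := exists_between htT
  have hT' : 0 < T' := ht.trans_lt htT'
  obtain ⟨C, hC, hb⟩ := h.lineDeriv hg (by simp) hT' hT'T
  have ha : t / (2 * T') < 1 / 2 := by
    rw [div_lt_div_iff₀ (by positivity) two_pos]
    linarith
  have hu : ∀ᶠ w : ℝ in 𝓝 u, ∑ i, Function.update x j w i ^ 2 <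
      ∑ i, Function.update x j u i ^ 2 + 1 := by
    refine ContinuousAt.eventually_lt (Continuous.continuousAt ?_) continuousAt_const (by simp)
    have : Continuous (Function.update x j) := continuous_const.update j continuous_id
    fun_prop
  refine (hasDerivAt_integral_of_dominated_loc_of_deriv_le
    (F := fun w y => g (heatPoint n t (Function.update x j w) y))
    (F' := fun w y => lineDeriv ℂ g (heatPoint n t (Function.update x j w) y)
      (EuclideanSpace.single j 1))
    hu (Eventually.of_forall fun w =>
      (hg.measurable.comp (continuous_heatPoint_right t _).measurable).aestronglyMeasurable)
    (h.integrable_comp_heatPoint hg.measurable ht htT _)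
    (hg.lineDeriv.measurable.comp (continuous_heatPoint_right t _).measurable).aestronglyMeasurable
    (ae_of_all _ fun y w hw => norm_comp_heatPoint_le hT' hC hb ht le_rfl (le_of_lt hw) y)
    ((integrable_exp_mul_sum_sq ha).const_mul _)
    (ae_of_all _ fun y w _ => ?_)).2
  have := (hg.hasDerivAt (heatPoint n t (Function.update x j 0) y) w).comp_ofReal
  simpa only [← heatPoint_update] using this

lemma integral_mul_comp_heatPoint {g : EuclideanSpace ℂ (Fin n) → ℂ} {T t : ℝ} (j : Fin n)
    (hg : EntireAlong (EuclideanSpace.single j (1 : ℂ)) g) (h : HasGaussianGrowth T g)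
    (ht : 0 ≤ t) (htT : t < T) (x : Fin n → ℝ) :
    ∫ y, (y j : ℂ) * g (heatPoint n t x y) ∂stdGaussianPi n =
      Complex.I * (√(2 * t) : ℂ) *
        heatSol n (fun z => lineDeriv ℂ g z (EuclideanSpace.single j 1)) t x := by
  obtain ⟨T', htT', hT'T⟩ := exists_between htT
  have hT' : 0 < T' := ht.trans_lt htT'
  rw [heatSol, ← integral_const_mul]
  refine integral_mul_stdGaussianPi j (h.integrable_comp_heatPoint hg.measurable ht htT x)
    (((h.lineDeriv hg (by simp) hT' hT'T).integrable_comp_heatPoint hg.lineDeriv.measurable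
      ht htT' x).const_mul _)
    (h.integrable_mul_comp_heatPoint hg.measurable ht htT x j) fun y => ?_
  have h1 : HasDerivAt (fun s : ℝ => Complex.I * (√(2 * t) : ℂ) * (s : ℂ))
      (Complex.I * (√(2 * t) : ℂ)) 0 := by
    simpa using Complex.ofRealCLM.hasDerivAt.const_mul (Complex.I * (√(2 * t) : ℂ))
  have h2 := hg.hasDerivAt (heatPoint n t x y) (Complex.I * (√(2 * t) : ℂ) * ((0 : ℝ) : ℂ))
  have h3 := h2.comp (0 : ℝ) h1
  rw [HasLineDerivAt]
  simp_rw [heatPoint_add_smul_single]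
  refine h3.congr_deriv ?_
  simp [mul_comm]

lemma Differentiable.entireAlong {h : EuclideanSpace ℂ (Fin n) → ℂ} (hh : Differentiable ℂ h)
    (v : EuclideanSpace ℂ (Fin n)) : EntireAlong v h where
  measurable := hh.continuous.measurable
  differentiable z := hh.comp (by fun_prop)

lemma hasDerivAt_heatSol_time {h : EuclideanSpace ℂ (Fin n) → ℂ} {T t : ℝ}
    (hh : Differentiable ℂ h) (hg : HasGaussianGrowth T h) (ht : 0 < t) (htT : t < T)
    (x : Fin n → ℝ) :
    HasDerivAt (fun s => heatSol n h s x)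
      (∫ y, ∑ j, Complex.I / (√(2 * t) : ℂ) * ((y j : ℂ) *
        lineDeriv ℂ h (heatPoint n t x y) (EuclideanSpace.single j 1)) ∂stdGaussianPi n) t := by
  obtain ⟨T', htT', hT'T⟩ := exists_between htT
  obtain ⟨a, hta, haT'⟩ := exists_between htT'
  have hT' : 0 < T' := ht.trans htT'
  have ha : a / (2 * T') < 1 / 2 := by
    rw [div_lt_div_iff₀ (by positivity) two_pos]
    linarith
  choose C hC hb using fun j : Fin n =>
    hg.lineDeriv (hh.entireAlong (EuclideanSpace.single j 1)) (by simp) hT' hT'T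
  refine (hasDerivAt_integral_of_dominated_loc_of_deriv_le
    (F := fun s y => h (heatPoint n s x y))
    (F' := fun s y => ∑ j, Complex.I / (√(2 * s) : ℂ) * ((y j : ℂ) *
        lineDeriv ℂ h (heatPoint n s x y) (EuclideanSpace.single j 1)))
    (bound := fun y => ∑ j, 1 / √t * (C j * Real.exp ((∑ i, x i ^ 2) / (4 * T')) *
      (|y j| * Real.exp (a / (2 * T') * ∑ i, y i ^ 2))))
    (Ioo_mem_nhds (half_lt_self ht) hta) (Eventually.of_forall fun s =>
      (hh.continuous.comp (continuous_heatPoint_right s x)).aestronglyMeasurable)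
    (hg.integrable_comp_heatPoint hh.continuous.measurable ht.le htT x)
    ?_ (ae_of_all _ fun y s hs => ?_) ?_ (ae_of_all _ fun y s hs => ?_)).2
  · refine (Finset.measurable_sum _ fun j _ => Measurable.const_mul ?_ _).aestronglyMeasurable
    exact Measurable.mul (by fun_prop) ((hh.entireAlong _).lineDeriv.measurable.comp
      (continuous_heatPoint_right t x).measurable)
  · have hs0 : 0 < s := (half_pos ht).trans hs.1
    refine norm_sum_le_of_le _ fun j _ => ?_
    rw [norm_mul, norm_mul, norm_div, Complex.norm_I, Complex.norm_real, Complex.norm_real,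
      Real.norm_eq_abs, Real.norm_eq_abs, abs_of_nonneg (Real.sqrt_nonneg _),
      mul_left_comm (C j * _)]
    have hts : t ≤ 2 * s := by linarith [hs.1]
    gcongr
    exact norm_comp_heatPoint_le hT' (hC j) (hb j) hs0.le hs.2.le le_rfl y
  · exact integrable_finsetSum _ fun j _ =>
      ((integrable_abs_mul_exp_mul_sum_sq ha j).const_mul _).const_mul _
  · have hs0 : 0 < s := (half_pos ht).trans hs.1
    have := ((hh (heatPoint n s x y)).hasFDerivAt.restrictScalars ℝ).comp_hasDerivAt s
      (hasDerivAt_heatPoint hs0 x y)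
    refine this.congr_deriv ?_
    simp [(hh _).lineDeriv_eq_fderiv, mul_assoc]

end HeatPoint

/-- for an entire `h : ℂⁿ → ℂ` with `|h(z)| ≤ C·exp(‖z‖²/(4T))`, the function
`f(t,x) = ∫ h(x + i√(2t) y) dγₙ(y)` is well-defined on `[0,T) × ℝⁿ`, continuous there, equals `h`
at `t = 0`, and solves the backward heat equation `∂f/∂t = -∑ⱼ ∂²f/∂xⱼ²` on `(0,T) × ℝⁿ`. -/
theorem backward_heat_equation_via_wrong_sign_gaussians
    (n : ℕ) (hn : 1 ≤ n) (h : EuclideanSpace ℂ (Fin n) → ℂ)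
    (hh : Differentiable ℂ h) (T C : ℝ) (hT : 0 < T) (hC : 0 < C)
    (hgrowth : ∀ z : EuclideanSpace ℂ (Fin n), ‖h z‖ ≤ C * Real.exp (‖z‖ ^ 2 / (4 * T))) :
    -- (1) well-definedness
    (∀ t ∈ Set.Ico (0 : ℝ) T, ∀ x : Fin n → ℝ,
      Integrable (fun y : Fin n → ℝ => h (heatPoint n t x y)) (stdGaussianPi n)) ∧
    -- (2) continuity on [0,T) × ℝⁿ and initial condition
    ContinuousOn (fun p : ℝ × (Fin n → ℝ) => heatSol n h p.1 p.2)
      (Set.Ico (0 : ℝ) T ×ˢ Set.univ) ∧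
    (∀ x : Fin n → ℝ, heatSol n h 0 x = h (heatPoint n 0 x 0)) ∧
    -- (3) the backward heat equation on (0,T) × ℝⁿ
    (∀ t ∈ Set.Ioo (0 : ℝ) T, ∀ x : Fin n → ℝ,
      ∃ (dt : ℂ) (dxx : Fin n → ℂ),
        HasDerivAt (fun s : ℝ => heatSol n h s x) dt t ∧
        (∀ j : Fin n,
          HasDerivAt (fun u : ℝ => heatSol n h t (Function.update x j u))
            (deriv (fun u : ℝ => heatSol n h t (Function.update x j u)) (x j)) (x j) ∧
          HasDerivAt (deriv (fun u : ℝ => heatSol n h t (Function.update x j u))) (dxx j) (x j)) ∧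
        dt = -(∑ j, dxx j)) := by
  have hg : HasGaussianGrowth T h := ⟨C, hC.le, hgrowth⟩
  refine ⟨fun t ht x => hg.integrable_comp_heatPoint hh.continuous.measurable ht.1 ht.2 x,
    continuousOn_heatSol hh.continuous hT hg, fun x => ?_, fun t ht x => ?_⟩
  · have (y : Fin n → ℝ) : heatPoint n 0 x y = heatPoint n 0 x 0 := by
      ext j
      simp [heatPoint_apply]
    simp [heatSol, this]
  obtain ⟨T', htT', hT'T⟩ := exists_between ht.2
  have hT' : 0 < T' := ht.1.trans htT'
  have he (j : Fin n) := hh.entireAlong (EuclideanSpace.single j (1 : ℂ))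
  have hg' (j : Fin n) := hg.lineDeriv (he j) (by simp) hT' hT'T
  have hx (j : Fin n) := hasDerivAt_heatSol_update j (he j) hg ht.1.le ht.2 x
  have hxx (j : Fin n) := hasDerivAt_heatSol_update j (he j).lineDeriv (hg' j) ht.1.le htT' x
  refine ⟨_, fun j => heatSol n (fun z => lineDeriv ℂ
      (fun z => lineDeriv ℂ h z (EuclideanSpace.single j 1)) z (EuclideanSpace.single j 1)) t x,
    hasDerivAt_heatSol_time hh hg ht.1 ht.2 x, fun j => ⟨?_, ?_⟩, ?_⟩
  · exact (hx j (x j)).differentiableAt.hasDerivAt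
  · rw [funext fun u => (hx j u).deriv]
    simpa using hxx j (x j)
  · rw [integral_finsetSum _ fun j _ => ((hg' j).integrable_mul_comp_heatPoint
      (he j).lineDeriv.measurable ht.1.le htT' x j).const_mul _, ← Finset.sum_neg_distrib]
    refine Finset.sum_congr rfl fun j _ => ?_
    rw [integral_const_mul,
      integral_mul_comp_heatPoint j (he j).lineDeriv (hg' j) ht.1.le htT' x]
    have : (√(2 * t) : ℂ) ≠ 0 := by
      exact_mod_cast (Real.sqrt_pos.2 (mul_pos two_pos ht.1)).ne'
    field_simp
    simp
end

section
/- For every λ ∈ (0,1) and every t ∈ [−1,1], the series ∑_{l=1}^{∞} λ^l · (2l+1)/(2l(l+1)) · P_l(t) converges absolutely and its sum is at least −9/8. -/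
noncomputable section

/-- The `l`-th Legendre polynomial, via Rodrigues' formula
`P_l(x) = (1/(2^l l!)) (d/dx)^l (x² − 1)^l`. -/
def legendreP (l : ℕ) (x : ℝ) : ℝ :=
  (1 / (2 ^ l * Nat.factorial l)) *
    (Polynomial.derivative^[l] (((Polynomial.X : Polynomial ℝ) ^ 2 - 1) ^ l)).eval x

open Finset in
theorem legendreP_eq_sum_choose_sq (l : ℕ) (x : ℝ) :
    legendreP l x =
      ∑ k ∈ range (l + 1), (l.choose k : ℝ) ^ 2 * ((x - 1) / 2) ^ k * ((x + 1) / 2) ^ (l - k) := by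
  have hfac : ((Polynomial.X : Polynomial ℝ) ^ 2 - 1) ^ l =
      (Polynomial.X - Polynomial.C 1) ^ l * (Polynomial.X + Polynomial.C 1) ^ l := by
    rw [← mul_pow]
    congr 1
    simp only [map_one]
    ring
  rw [legendreP, hfac, Polynomial.iterate_derivative_mul, Polynomial.eval_finsetSum,
    Finset.mul_sum]
  refine Finset.sum_congr rfl fun k hk => ?_
  have hkl : k ≤ l := Nat.lt_succ_iff.mp (Finset.mem_range.mp hk)
  rw [Polynomial.iterate_derivative_X_sub_pow, Polynomial.iterate_derivative_X_add_pow,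
    Nat.sub_sub_self hkl]
  simp only [nsmul_eq_mul, Polynomial.eval_mul, Polynomial.eval_natCast, Polynomial.eval_pow,
    Polynomial.eval_sub, Polynomial.eval_add, Polynomial.eval_X, Polynomial.eval_C]
  rw [Nat.descFactorial_eq_factorial_mul_choose, Nat.descFactorial_eq_factorial_mul_choose,
    Nat.choose_symm hkl, div_pow, div_pow]
  have hc : (l.choose k : ℝ) * k.factorial * (l - k).factorial = l.factorial := by
    exact_mod_cast Nat.choose_mul_factorial_mul_factorial hkl
  have hp : (2 : ℝ) ^ l = 2 ^ k * 2 ^ (l - k) := by rw [← pow_add, Nat.add_sub_cancel' hkl]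
  have hl : (l.factorial : ℝ) ≠ 0 := by positivity
  push_cast
  rw [hp]
  field_simp
  rw [← hc]
  ring

/-- The integrand base `t + i √(1 - t²) cos φ` of Laplace's first integral for `P_l(t)`. -/
def laplaceBase (t φ : ℝ) : ℂ :=
  t + Complex.I * (√(1 - t ^ 2) * Real.cos φ : ℝ)

theorem continuous_laplaceBase (t : ℝ) : Continuous (laplaceBase t) := by
  unfold laplaceBase
  fun_prop

theorem norm_laplaceBase_le_one {t : ℝ} (ht : t ∈ Set.Icc (-1 : ℝ) 1) (φ : ℝ) :
    ‖laplaceBase t φ‖ ≤ 1 := by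
  have h : 0 ≤ 1 - t ^ 2 := by nlinarith [ht.1, ht.2]
  rw [← sq_le_one_iff₀ (norm_nonneg _), ← Complex.normSq_eq_norm_sq, Complex.normSq_apply]
  simp only [laplaceBase, Complex.add_re, Complex.ofReal_re, Complex.mul_re, Complex.I_re,
    Complex.I_im, Complex.ofReal_im, Complex.add_im, Complex.mul_im]
  nlinarith [Real.sq_sqrt h, Real.cos_sq_le_one φ]

theorem laplaceBase_eq_mul {t : ℝ} (ht : t ∈ Set.Icc (-1 : ℝ) 1) (φ : ℝ) :
    laplaceBase t φ =
      (Complex.I * √((1 - t) / 2) * Complex.exp (φ * Complex.I) + √((1 + t) / 2)) *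
        (Complex.I * √((1 - t) / 2) * Complex.exp (-(φ * Complex.I)) + √((1 + t) / 2)) := by
  have ha : (0 : ℝ) ≤ (1 - t) / 2 := by linarith [ht.2]
  have hb : (0 : ℝ) ≤ (1 + t) / 2 := by linarith [ht.1]
  have hab : √(1 - t ^ 2) = 2 * (√((1 - t) / 2) * √((1 + t) / 2)) := by
    rw [← Real.sqrt_mul ha, show 1 - t ^ 2 = 2 ^ 2 * ((1 - t) / 2 * ((1 + t) / 2)) by ring,
      Real.sqrt_mul (by norm_num), Real.sqrt_sq (by norm_num)]
  have ha2 : ((√((1 - t) / 2) : ℝ) : ℂ) ^ 2 = (1 - t) / 2 := by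
    rw [← Complex.ofReal_pow, Real.sq_sqrt ha]; push_cast; ring
  have hb2 : ((√((1 + t) / 2) : ℝ) : ℂ) ^ 2 = (1 + t) / 2 := by
    rw [← Complex.ofReal_pow, Real.sq_sqrt hb]; push_cast; ring
  have he : Complex.exp (φ * Complex.I) * Complex.exp (-(φ * Complex.I)) = 1 := by
    rw [← Complex.exp_add]; simp
  have hcos : (Real.cos φ : ℂ) =
      (Complex.exp (φ * Complex.I) + Complex.exp (-(φ * Complex.I))) / 2 := by
    rw [Complex.ofReal_cos, Complex.cos, neg_mul]
  rw [laplaceBase, hab]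
  push_cast [-Complex.ofReal_cos]
  rw [hcos]
  linear_combination (-(Complex.I ^ 2 * (√((1 - t) / 2) : ℝ) ^ 2)) * he - Complex.I ^ 2 * ha2 - hb2
    - (1 - (t : ℂ)) / 2 * Complex.I_sq

theorem integral_exp_mul_I_pow_mul_exp_neg_pow (j k : ℕ) :
    ∫ φ in (0 : ℝ)..2 * Real.pi,
      Complex.exp (φ * Complex.I) ^ j * Complex.exp (-(φ * Complex.I)) ^ k =
      if j = k then (2 * Real.pi : ℂ) else 0 := by
  have h : ∀ φ : ℝ, Complex.exp (φ * Complex.I) ^ j * Complex.exp (-(φ * Complex.I)) ^ k =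
      Complex.exp ((((j : ℤ) - k : ℤ) * Complex.I) * φ) := by
    intro φ
    rw [← Complex.exp_nat_mul, ← Complex.exp_nat_mul, ← Complex.exp_add]
    congr 1
    push_cast
    ring
  simp_rw [h]
  split_ifs with hjk
  · simp [hjk]
  · have hne : (((j : ℤ) - k : ℤ) : ℂ) * Complex.I ≠ 0 := by
      refine mul_ne_zero (Int.cast_ne_zero.mpr ?_) Complex.I_ne_zero
      omega
    rw [integral_exp_mul_complex hne]
    have : (((j : ℤ) - k : ℤ) : ℂ) * Complex.I * ((2 * Real.pi : ℝ) : ℂ) =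
        (((j : ℤ) - k : ℤ) : ℂ) * (2 * Real.pi * Complex.I) := by
      push_cast; ring
    rw [this, Complex.exp_int_mul_two_pi_mul_I]
    simp

open Finset in
/-- Laplace's first integral for the Legendre polynomials. -/
theorem integral_laplaceBase_pow {t : ℝ} (ht : t ∈ Set.Icc (-1 : ℝ) 1) (l : ℕ) :
    ∫ φ in (0 : ℝ)..2 * Real.pi, laplaceBase t φ ^ l =
      ((2 * Real.pi * legendreP l t : ℝ) : ℂ) := by
  have ha : (0 : ℝ) ≤ (1 - t) / 2 := by linarith [ht.2]
  have hb : (0 : ℝ) ≤ (1 + t) / 2 := by linarith [ht.1]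
  set a : ℂ := Complex.I * √((1 - t) / 2) with ha_def
  set b : ℂ := ((√((1 + t) / 2) : ℝ) : ℂ) with hb_def
  have ha2 : a ^ 2 = (((t - 1) / 2 : ℝ) : ℂ) := by
    rw [ha_def, mul_pow, Complex.I_sq, ← Complex.ofReal_pow, Real.sq_sqrt ha]
    push_cast; ring
  have hb2 : b ^ 2 = (((t + 1) / 2 : ℝ) : ℂ) := by
    rw [hb_def, ← Complex.ofReal_pow, Real.sq_sqrt hb]
    push_cast; ring
  have hexp : ∀ φ : ℝ, laplaceBase t φ ^ l =
      ∑ j ∈ range (l + 1), ∑ k ∈ range (l + 1),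
        (a ^ j * b ^ (l - j) * l.choose j * (a ^ k * b ^ (l - k) * l.choose k)) *
          (Complex.exp (φ * Complex.I) ^ j * Complex.exp (-(φ * Complex.I)) ^ k) := by
    intro φ
    rw [laplaceBase_eq_mul ht, mul_pow, add_pow, add_pow, sum_mul_sum]
    refine sum_congr rfl fun j _ => sum_congr rfl fun k _ => ?_
    rw [mul_pow, mul_pow _ (Complex.exp (-(φ * Complex.I)))]
    ring
  simp_rw [hexp]
  rw [intervalIntegral.integral_finsetSum fun j _ => Continuous.intervalIntegrable (by fun_prop) _ _]
  have hinner : ∀ j ∈ range (l + 1),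
      (∫ φ in (0 : ℝ)..2 * Real.pi, ∑ k ∈ range (l + 1),
        (a ^ j * b ^ (l - j) * l.choose j * (a ^ k * b ^ (l - k) * l.choose k)) *
          (Complex.exp (φ * Complex.I) ^ j * Complex.exp (-(φ * Complex.I)) ^ k)) =
      (a ^ j * b ^ (l - j) * l.choose j) ^ 2 * (2 * Real.pi) := by
    intro j hj
    rw [intervalIntegral.integral_finsetSum
      fun k _ => Continuous.intervalIntegrable (by fun_prop) _ _]
    simp_rw [intervalIntegral.integral_const_mul, integral_exp_mul_I_pow_mul_exp_neg_pow]
    simp only [mul_ite, mul_zero, sum_ite_eq, hj, if_true]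
    ring
  rw [sum_congr rfl hinner, legendreP_eq_sum_choose_sq, ← sum_mul]
  push_cast
  rw [mul_comm]
  congr 1
  refine sum_congr rfl fun k _ => ?_
  push_cast at ha2 hb2
  rw [← ha2, ← hb2]
  ring

theorem integral_re_laplaceBase_pow {t : ℝ} (ht : t ∈ Set.Icc (-1 : ℝ) 1) (l : ℕ) :
    ∫ φ in (0 : ℝ)..2 * Real.pi, (laplaceBase t φ ^ l).re = 2 * Real.pi * legendreP l t := by
  have h := Complex.reCLM.intervalIntegral_comp_comm
    (((continuous_laplaceBase t).pow l).intervalIntegrable (μ := MeasureTheory.volume)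
      0 (2 * Real.pi))
  simp only [Pi.pow_apply, Complex.reCLM_apply, integral_laplaceBase_pow ht, Complex.ofReal_re] at h
  exact h

theorem abs_legendreP_le_one {t : ℝ} (ht : t ∈ Set.Icc (-1 : ℝ) 1) (l : ℕ) :
    |legendreP l t| ≤ 1 := by
  have hpi := Real.two_pi_pos
  have h := intervalIntegral.norm_integral_le_of_norm_le_const (a := 0) (b := 2 * Real.pi)
    (f := fun φ => (laplaceBase t φ ^ l).re) (C := 1) fun φ _ => by
      refine (Complex.abs_re_le_norm _).trans ?_
      rw [norm_pow]
      exact pow_le_one₀ (norm_nonneg _) (norm_laplaceBase_le_one ht φ)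
  rw [integral_re_laplaceBase_pow ht, Real.norm_eq_abs, abs_mul, abs_of_pos hpi, sub_zero,
    abs_of_pos hpi, one_mul] at h
  exact le_of_mul_le_mul_left (by linarith) hpi

theorem integral_le_tsum_integral {F : ℕ → ℝ → ℝ} {g : ℝ → ℝ} {u : ℕ → ℝ} {a b : ℝ}
    (hab : a ≤ b) (hF : ∀ n, Continuous (F n)) (hg : Continuous g) (hu : Summable u)
    (hFu : ∀ n, ∀ x ∈ Set.Icc a b, |F n x| ≤ u n)
    (hgF : ∀ x ∈ Set.Icc a b, g x ≤ ∑' n, F n x) :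
    ∫ x in a..b, g x ≤ ∑' n, ∫ x in a..b, F n x := by
  have hsub : Set.uIoc a b ⊆ Set.Icc a b := by
    rw [Set.uIoc_of_le hab]; exact Set.Ioc_subset_Icc_self
  have hsum := intervalIntegral.hasSum_integral_of_dominated_convergence
    (μ := MeasureTheory.volume) (a := a) (b := b) (F := F) (f := fun x => ∑' n, F n x)
    (fun n _ => u n) (fun n => (hF n).aestronglyMeasurable)
    (fun n => .of_forall fun x hx => hFu n x (hsub hx))
    (.of_forall fun _ _ => hu) intervalIntegrable_const
    (.of_forall fun x hx => (Summable.of_norm_bounded hu fun n => hFu n x (hsub hx)).hasSum)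
  rw [hsum.tsum_eq]
  refine intervalIntegral.integral_mono_on hab (hg.intervalIntegrable _ _) ?_ hgF
  refine ContinuousOn.intervalIntegrable ?_
  rw [Set.uIcc_of_le hab]
  exact continuousOn_tsum (fun n => (hF n).continuousOn) hu hFu

theorem neg_one_le_re_div_one_sub_mul {w : ℂ} (hw : ‖w‖ < 1) {s : ℝ} (hs : s ∈ Set.Icc (0 : ℝ) 1) :
    -1 ≤ (w / (1 - s * w)).re := by
  have hsw : ‖(s : ℂ) * w‖ < 1 := by
    rw [norm_mul, Complex.norm_real, Real.norm_of_nonneg hs.1]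
    nlinarith [norm_nonneg w, hs.2]
  have hne : (1 : ℂ) - s * w ≠ 0 := by
    intro h
    rw [← sub_eq_zero.mp h, norm_one] at hsw
    exact lt_irrefl _ hsw
  have hsq : w.re ^ 2 + w.im ^ 2 < 1 := by
    have := Complex.normSq_eq_norm_sq w
    rw [Complex.normSq_apply] at this
    nlinarith [norm_nonneg w]
  have hre : |w.re| ≤ 1 := (Complex.abs_re_le_norm w).trans hw.le
  have hpos := Complex.normSq_pos.mpr hne
  rw [Complex.div_re, ← add_div, le_div_iff₀ hpos, Complex.normSq_apply]
  simp only [Complex.sub_re, Complex.sub_im, Complex.one_re, Complex.one_im, Complex.mul_re,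
    Complex.mul_im, Complex.ofReal_re, Complex.ofReal_im, zero_mul, sub_zero, add_zero, zero_sub]
  obtain ⟨h0, h1⟩ := hs
  obtain ⟨hm, hp⟩ := abs_le.mp hre
  have key : 0 ≤ 1 + (1 - 2 * s) * w.re - s * (1 - s) * (w.re ^ 2 + w.im ^ 2) := by
    have h2 : s * (1 - s) * (w.re ^ 2 + w.im ^ 2) ≤ s * (1 - s) * 1 :=
      mul_le_mul_of_nonneg_left hsq.le (mul_nonneg h0 (by linarith))
    rcases le_total s (1 / 2) with h | h <;> nlinarith
  nlinarith

theorem hasSum_re_pow_succ_mul_pow {w : ℂ} (hw : ‖w‖ < 1) {s : ℝ} (hs : s ∈ Set.Icc (0 : ℝ) 1) :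
    HasSum (fun n : ℕ => s ^ n * (w ^ (n + 1)).re) (w / (1 - s * w)).re := by
  have hsw : ‖(s : ℂ) * w‖ < 1 := by
    rw [norm_mul, Complex.norm_real, Real.norm_of_nonneg hs.1]
    nlinarith [norm_nonneg w, hs.2]
  have h := Complex.hasSum_re ((hasSum_geometric_of_norm_lt_one hsw).mul_left w)
  rw [← div_eq_mul_inv] at h
  refine h.congr_fun fun n => ?_
  rw [← Complex.re_ofReal_mul]
  congr 1
  push_cast
  ring

theorem integral_pow_mul_one_add_div_two (n : ℕ) :
    ∫ s in (0 : ℝ)..1, s ^ n * ((1 + s) / 2) =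
      (2 * ((n : ℝ) + 1) + 1) / (2 * ((n : ℝ) + 1) * ((n : ℝ) + 2)) := by
  have h : ∀ s : ℝ, s ^ n * ((1 + s) / 2) = 1 / 2 * s ^ n + 1 / 2 * s ^ (n + 1) := fun s => by ring
  simp_rw [h]
  rw [intervalIntegral.integral_add (Continuous.intervalIntegrable (by fun_prop) _ _)
    (Continuous.intervalIntegrable (by fun_prop) _ _), intervalIntegral.integral_const_mul,
    intervalIntegral.integral_const_mul, integral_pow, integral_pow]
  push_cast
  have : (n : ℝ) + 1 ≠ 0 := by positivity
  have : (n : ℝ) + 2 ≠ 0 := by positivity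
  have : (n : ℝ) + 1 + 1 ≠ 0 := by positivity
  simp only [one_pow, zero_pow (Nat.succ_ne_zero _)]
  field_simp
  ring

theorem neg_three_div_four_le_tsum_re_pow {w : ℂ} (hw : ‖w‖ < 1) :
    -3 / 4 ≤ ∑' n : ℕ,
      (2 * ((n : ℝ) + 1) + 1) / (2 * ((n : ℝ) + 1) * ((n : ℝ) + 2)) * (w ^ (n + 1)).re := by
  have h := integral_le_tsum_integral (a := 0) (b := 1)
    (F := fun n s => s ^ n * ((1 + s) / 2) * (w ^ (n + 1)).re) (g := fun s => -((1 + s) / 2))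
    (u := fun n => ‖w‖ ^ n) zero_le_one (fun n => by fun_prop) (by fun_prop)
    (summable_geometric_of_lt_one (norm_nonneg w) hw) ?_ ?_
  · simp_rw [intervalIntegral.integral_mul_const, integral_pow_mul_one_add_div_two] at h
    refine le_trans (le_of_eq ?_) h
    have h0 := integral_pow_mul_one_add_div_two 0
    simp only [pow_zero, one_mul] at h0
    rw [intervalIntegral.integral_neg, h0]
    norm_num
  · intro n s hs
    have h1 : |(w ^ (n + 1)).re| ≤ ‖w‖ ^ n := by
      refine (Complex.abs_re_le_norm _).trans ?_
      rw [norm_pow]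
      exact pow_le_pow_of_le_one (norm_nonneg w) hw.le n.le_succ
    have h2 : |s ^ n * ((1 + s) / 2)| ≤ 1 := by
      rw [abs_of_nonneg (mul_nonneg (pow_nonneg hs.1 n) (by linarith [hs.1]))]
      exact mul_le_one₀ (pow_le_one₀ hs.1 hs.2) (by linarith [hs.1]) (by linarith [hs.2])
    rw [abs_mul]
    simpa using mul_le_mul h2 h1 (abs_nonneg _) zero_le_one
  · intro s hs
    have hsum := (hasSum_re_pow_succ_mul_pow hw hs).mul_left ((1 + s) / 2)
    have heq : ∑' n : ℕ, s ^ n * ((1 + s) / 2) * (w ^ (n + 1)).re =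
        (1 + s) / 2 * (w / (1 - s * w)).re := by
      rw [← hsum.tsum_eq]
      exact tsum_congr fun n => by ring
    rw [heq]
    nlinarith [neg_one_le_re_div_one_sub_mul hw hs, hs.1]

theorem two_mul_add_one_div_le_one (n : ℕ) :
    (2 * ((n : ℝ) + 1) + 1) / (2 * ((n : ℝ) + 1) * ((n : ℝ) + 2)) ≤ 1 := by
  rw [div_le_one (by positivity)]
  nlinarith [Nat.cast_nonneg (α := ℝ) n]

/-- for `λ ∈ (0,1)` and `t ∈ [−1,1]`, the series
`∑_{l≥1} λ^l (2l+1)/(2l(l+1)) P_l(t)` converges absolutely and its sum is `≥ −9/8`. -/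
theorem legendre_series_lower_bound
    (lam t : ℝ) (hlam : lam ∈ Set.Ioo (0:ℝ) 1) (ht : t ∈ Set.Icc (-1:ℝ) 1) :
    (Summable fun n : ℕ =>
      |lam ^ (n + 1) * (2 * ((n:ℝ) + 1) + 1) / (2 * ((n:ℝ) + 1) * ((n:ℝ) + 2)) *
        legendreP (n + 1) t|) ∧
    -9/8 ≤ ∑' n : ℕ,
      lam ^ (n + 1) * (2 * ((n:ℝ) + 1) + 1) / (2 * ((n:ℝ) + 1) * ((n:ℝ) + 2)) *
        legendreP (n + 1) t := by
  obtain ⟨hlam0, hlam1⟩ := hlam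
  have hgeom : Summable fun n : ℕ => lam ^ (n + 1) :=
    (summable_nat_add_iff 1).mpr (summable_geometric_of_lt_one hlam0.le hlam1)
  have hbound : ∀ (n : ℕ) {x : ℝ}, |x| ≤ 1 →
      |lam ^ (n + 1) * (2 * ((n:ℝ) + 1) + 1) / (2 * ((n:ℝ) + 1) * ((n:ℝ) + 2)) * x| ≤
        lam ^ (n + 1) := by
    intro n x hx
    have hpos : 0 ≤ (2 * ((n : ℝ) + 1) + 1) / (2 * ((n : ℝ) + 1) * ((n : ℝ) + 2)) := by positivity
    rw [mul_div_assoc, mul_assoc, abs_mul, abs_mul, abs_of_pos (pow_pos hlam0 _),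
      abs_of_nonneg hpos]
    exact mul_le_of_le_one_right (pow_pos hlam0 _).le
      (mul_le_one₀ (two_mul_add_one_div_le_one n) (abs_nonneg x) hx)
  refine ⟨Summable.of_nonneg_of_le (fun _ => abs_nonneg _)
    (fun n => hbound n (abs_legendreP_le_one ht _)) hgeom, ?_⟩
  have h := integral_le_tsum_integral (a := 0) (b := 2 * Real.pi)
    (F := fun n φ => lam ^ (n + 1) * (2 * ((n:ℝ) + 1) + 1) / (2 * ((n:ℝ) + 1) * ((n:ℝ) + 2)) *
      (laplaceBase t φ ^ (n + 1)).re) (g := fun _ => -3 / 4)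
    Real.two_pi_pos.le
    (fun n => continuous_const.mul
      (Complex.continuous_re.comp ((continuous_laplaceBase t).pow (n + 1))))
    continuous_const hgeom ?_ ?_
  · simp_rw [intervalIntegral.integral_const_mul, integral_re_laplaceBase_pow ht,
      mul_left_comm _ (2 * Real.pi)] at h
    rw [tsum_mul_left, intervalIntegral.integral_const, sub_zero, smul_eq_mul] at h
    linarith [le_of_mul_le_mul_left h Real.two_pi_pos]
  · intro n φ _
    refine hbound n ((Complex.abs_re_le_norm _).trans ?_)
    rw [norm_pow]
    exact pow_le_one₀ (norm_nonneg _) (norm_laplaceBase_le_one ht φ)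
  · intro φ _
    have hw : ‖(lam : ℂ) * laplaceBase t φ‖ < 1 := by
      rw [norm_mul, Complex.norm_real, Real.norm_of_nonneg hlam0.le]
      exact (mul_le_of_le_one_right hlam0.le (norm_laplaceBase_le_one ht φ)).trans_lt hlam1
    refine (neg_three_div_four_le_tsum_re_pow hw).trans (le_of_eq (tsum_congr fun n => ?_))
    rw [mul_pow, ← Complex.ofReal_pow, Complex.re_ofReal_mul]
    ring
end
end

section
/- For every integer l ≥ 1, ∫_{−1}^{1} ln(1−x)·P_l(x) dx = −2/(l(l+1)). Moreover, for l = 0, ∫_{−1}^{1} ln(1−x)·P₀(x) dx = 2(ln 2 − 1). -/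
noncomputable section

open Polynomial in
/-- Differentiating `(X - a)^n * q` exactly `n` times and evaluating at `a` gives `n! * q(a)`. -/
lemma eval_iterate_derivative_X_sub_C_pow_mul {R : Type*} [CommRing R] (a : R) (n : ℕ) (q : R[X]) :
    (derivative^[n] ((X - C a) ^ n * q)).eval a = n.factorial * q.eval a := by
  induction n generalizing q with
  | zero => simp
  | succ n ih =>
    have h : derivative ((X - C a) ^ (n + 1) * q) =
        (X - C a) ^ n * (((n : R[X]) + 1) * q + (X - C a) * derivative q) := by
      simp only [derivative_mul, derivative_X_sub_C_pow, Nat.add_sub_cancel, map_natCast]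
      push_cast
      ring
    rw [Function.iterate_succ_apply, h, ih, Nat.factorial_succ]
    simp
    ring

open Polynomial in
/-- The iterated derivatives of `(X² - 1)^l` satisfy a second order differential equation. -/
lemma sq_sub_one_mul_iterate_derivative {R : Type*} [CommRing R] (l k : ℕ) :
    ((X : R[X]) ^ 2 - 1) * derivative^[k + 2] (((X : R[X]) ^ 2 - 1) ^ l) =
      2 * ((l : R[X]) - (k : R[X]) - 1) * X * derivative^[k + 1] (((X : R[X]) ^ 2 - 1) ^ l) +
        ((k : R[X]) + 1) * (2 * (l : R[X]) - (k : R[X])) *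
          derivative^[k] (((X : R[X]) ^ 2 - 1) ^ l) := by
  induction k with
  | zero =>
    have h : ((X : R[X]) ^ 2 - 1) * derivative ((X ^ 2 - 1) ^ l) =
        2 * (l : R[X]) * X * (X ^ 2 - 1) ^ l := by
      cases l with
      | zero => simp
      | succ l =>
        simp [derivative_pow, C_ofNat]
        ring
    have h' := congrArg derivative h
    simp only [derivative_mul, derivative_sub, derivative_X_sq, derivative_one, derivative_X,
      derivative_natCast, derivative_ofNat, C_ofNat] at h'
    simp only [Function.iterate_succ_apply', Function.iterate_zero, id_eq, Nat.cast_zero]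
    linear_combination h'
  | succ k ih =>
    have h' := congrArg derivative ih
    simp only [derivative_mul, derivative_add, derivative_sub, derivative_X_sq, derivative_one,
      derivative_X, derivative_natCast, derivative_ofNat, C_ofNat,
      ← Function.iterate_succ_apply' (derivative (R := R))] at h'
    push_cast
    linear_combination h'

lemma legendreP_one (l : ℕ) : legendreP l 1 = 1 := by
  have h : ((Polynomial.X : Polynomial ℝ) ^ 2 - 1) ^ l =
      (Polynomial.X - Polynomial.C 1) ^ l * (Polynomial.X + 1) ^ l := by
    rw [← mul_pow, Polynomial.C_1]
    ring
  rw [legendreP, h, eval_iterate_derivative_X_sub_C_pow_mul]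
  simp only [Polynomial.eval_pow, Polynomial.eval_add, Polynomial.eval_X, Polynomial.eval_one]
  have := Nat.factorial_ne_zero l
  field_simp
  norm_num

open Polynomial in
/-- Legendre's differential equation. -/
lemma exists_polynomial_eval_eq_legendreP (l : ℕ) :
    ∃ p : ℝ[X], (∀ x, legendreP l x = p.eval x) ∧
      derivative ((X ^ 2 - 1) * derivative p) = C ((l : ℝ) * (l + 1)) * p := by
  refine ⟨C (1 / (2 ^ l * (Nat.factorial l : ℝ))) * derivative^[l] (((X : ℝ[X]) ^ 2 - 1) ^ l),
    fun x => by rw [legendreP, eval_C_mul], ?_⟩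
  have h := sq_sub_one_mul_iterate_derivative (R := ℝ) l l
  simp only [Function.iterate_succ_apply'] at h
  simp only [derivative_mul, derivative_sub, derivative_X_sq, derivative_one, derivative_C,
    derivative_zero, C_ofNat, map_mul, map_add, map_natCast, map_one]
  linear_combination C (1 / (2 ^ l * (Nat.factorial l : ℝ))) * h

lemma intervalIntegrable_log_one_sub (a b : ℝ) :
    IntervalIntegrable (fun x => Real.log (1 - x)) MeasureTheory.volume a b := by
  simpa using (intervalIntegral.intervalIntegrable_log' (a := 1 - a) (b := 1 - b)).comp_sub_left 1

open Polynomial in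
/-- Integrating `log (1 - x)` against an eigenfunction of the Legendre operator. -/
lemma integral_log_one_sub_mul_eval {p : ℝ[X]} {c : ℝ} (hc : c ≠ 0)
    (hp : derivative ((X ^ 2 - 1) * derivative p) = C c * p) :
    ∫ x in (-1 : ℝ)..1, Real.log (1 - x) * p.eval x = -2 * p.eval 1 / c := by
  set q := (X ^ 2 - 1) * derivative p with hq
  have hqe (x : ℝ) : q.eval x = (x ^ 2 - 1) * (derivative p).eval x := by simp [hq]
  set F : ℝ → ℝ := fun x =>
    (Real.log (1 - x) * q.eval x - (x + 1) * p.eval x + q.eval x / c) / c with hF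
  have hcont : Continuous F := by
    have h1 : Continuous fun x : ℝ => Real.log (1 - x) * q.eval x := by
      have h2 : Continuous fun x : ℝ => (1 - x) * Real.log (1 - x) :=
        Real.continuous_mul_log.comp (continuous_const.sub continuous_id)
      have h3 : (fun x : ℝ => Real.log (1 - x) * q.eval x) = fun x : ℝ =>
          -((1 - x) * Real.log (1 - x) * (x + 1) * (derivative p).eval x) := by
        ext x
        rw [hqe]
        ring
      have := (derivative p).continuous
      rw [h3]
      exact ((h2.mul (by fun_prop)).mul this).neg
    have := p.continuous
    have := q.continuous
    fun_prop
  have hderiv : ∀ x ∈ Set.Ioo (-1 : ℝ) 1,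
      HasDerivAt F (Real.log (1 - x) * p.eval x) x := by
    intro x hx
    have hx1 : 1 - x ≠ 0 := by linarith [hx.2]
    have hlog := ((hasDerivAt_id x).const_sub 1).log hx1
    have hqd := q.hasDerivAt x
    rw [hp, eval_C_mul] at hqd
    have h := ((hlog.mul hqd).sub (((hasDerivAt_id x).add_const 1).mul (p.hasDerivAt x))).add
      (hqd.div_const c)
    refine (h.div_const c).congr_deriv ?_
    simp only [hqe, id_eq]
    field_simp
    ring
  rw [intervalIntegral.integral_eq_sub_of_hasDerivAt_of_le (by norm_num) hcont.continuousOn hderiv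
    ((intervalIntegrable_log_one_sub _ _).mul_continuousOn p.continuous.continuousOn)]
  simp only [hF, hqe]
  norm_num

/-- `∫_{−1}^{1} ln(1−x) P_l(x) dx = −2/(l(l+1))` for every `l ≥ 1`, and
`∫_{−1}^{1} ln(1−x) P₀(x) dx = 2(ln 2 − 1)`. -/
theorem log_against_legendre :
    (∀ l : ℕ, 1 ≤ l →
      ∫ x in (-1 : ℝ)..1, Real.log (1 - x) * legendreP l x = -2 / ((l : ℝ) * ((l : ℝ) + 1))) ∧
    ∫ x in (-1 : ℝ)..1, Real.log (1 - x) * legendreP 0 x = 2 * (Real.log 2 - 1) := by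
  refine ⟨fun l hl => ?_, ?_⟩
  · obtain ⟨p, hp, hode⟩ := exists_polynomial_eval_eq_legendreP l
    have hl0 : (l : ℝ) ≠ 0 := by positivity
    simp only [hp]
    rw [integral_log_one_sub_mul_eval (by positivity) hode, ← hp, legendreP_one, mul_one]
  · have h : ∀ x, legendreP 0 x = 1 := fun x => by simp [legendreP]
    simp only [h, mul_one]
    rw [intervalIntegral.integral_comp_sub_left (fun x => Real.log x) 1, integral_log]
    norm_num
    ring
end
end
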